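/- Let n ≥ 4 be divisible by 6. The graph-state vectors |G_r⟩ = (∏_{j=1}^n Z_j^{r_j}) |C_n⟩, r ∈ {0,1}^n, form an orthonormal basis of (ℂ²)^{⊗n} satisfying K_j |G_r⟩ = (−1)^{r_j} |G_r⟩ for all j. Moreover, for every n-qubit density matrix ρ and all distinct nontrivial g, h ∈ ℤ₂×ℤ₂, the triangle-game winning probability depends only on the graph-diagonal components of ρ: P_n^{(Q)}(g,h|ρ) = Σ_{r∈{0,1}^n} ⟨G_r|ρ|G_r⟩ · P_n^{(Q)}(g,h | |G_r⟩⟨G_r|). -/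

import Mathlib

open Matrix Complex
open scoped ComplexOrder

noncomputable section

/-- The state space of `n` qubits, as functions on classical bit strings. -/
abbrev QState (n : ℕ) := (Fin n → Fin 2) → ℂ

/-- Operators on `n` qubits: `2^n × 2^n` complex matrices. -/
abbrev Op (n : ℕ) := Matrix (Fin n → Fin 2) (Fin n → Fin 2) ℂ

/-- The single-qubit Pauli `X` matrix. -/
def Xmat : Matrix (Fin 2) (Fin 2) ℂ := !![0, 1; 1, 0]

/-- The single-qubit Pauli `Z` matrix. -/
def Zmat : Matrix (Fin 2) (Fin 2) ℂ := !![1, 0; 0, -1]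

/-- Map a 1-based cyclic site label `j ∈ {1,…,n}` (taken mod `n`) to an index in `Fin n`. -/
def site (n : ℕ) [NeZero n] (j : ℕ) : Fin n :=
  ⟨(j + (n - 1)) % n, Nat.mod_lt _ (Nat.pos_of_ne_zero (NeZero.ne n))⟩

/-- The operator acting as the single-qubit matrix `M` on qubit `i` and as identity elsewhere. -/
def onSite (n : ℕ) (i : Fin n) (M : Matrix (Fin 2) (Fin 2) ℂ) : Op n :=
  Matrix.of fun s t => (if ∀ k, k ≠ i → s k = t k then 1 else 0) * M (s i) (t i)

/-- Pauli `X` on (1-based, cyclic) site `j`. -/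
def PX (n : ℕ) [NeZero n] (j : ℕ) : Op n := onSite n (site n j) Xmat

/-- Pauli `Z` on (1-based, cyclic) site `j`. -/
def PZ (n : ℕ) [NeZero n] (j : ℕ) : Op n := onSite n (site n j) Zmat

/-- The cyclic cluster stabilizer `K_j = Z_{j-1} X_j Z_{j+1}` (for `1 ≤ j ≤ n`). -/
def Kstab (n : ℕ) [NeZero n] (j : ℕ) : Op n := PZ n (j - 1) * PX n j * PZ n (j + 1)

/-- The symmetry group `ℤ₂ × ℤ₂`. -/
abbrev G2 := ZMod 2 × ZMod 2

/-- The nontrivial element `x = (0,1)` of `ℤ₂ × ℤ₂`. -/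
def gx : G2 := (0, 1)

/-- The nontrivial element `y = (1,0)` of `ℤ₂ × ℤ₂`. -/
def gy : G2 := (1, 0)

/-- The nontrivial element `z = (1,1)` of `ℤ₂ × ℤ₂`. -/
def gz : G2 := (1, 1)

/-- The global symmetry representation `U((a,b)) = ∏_{j odd} X_j^a ∏_{j even} X_j^b`
on `n` qubits (`n` even), written as a product over the `n/2` two-site blocks. -/
def Usym (n : ℕ) [NeZero n] (g : G2) : Op n :=
  ((List.range (n / 2)).map
    (fun p => PX n (2 * p + 1) ^ g.1.val * PX n (2 * p + 2) ^ g.2.val)).prod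

/-- Left boundary operator `V^L_p((a,b))`: `Z^b` on qubit `2p-1` and `X^b Z^a` on qubit `2p`. -/
def VL (n : ℕ) [NeZero n] (p : ℕ) (g : G2) : Op n :=
  PZ n (2 * p - 1) ^ g.2.val * (PX n (2 * p) ^ g.2.val * PZ n (2 * p) ^ g.1.val)

/-- Right boundary operator `V^R_p((a,b))`: `Z^b X^a` on qubit `2p-1` and `Z^a` on qubit `2p`. -/
def VR (n : ℕ) [NeZero n] (p : ℕ) (g : G2) : Op n :=
  (PZ n (2 * p - 1) ^ g.2.val * PX n (2 * p - 1) ^ g.1.val) * PZ n (2 * p) ^ g.1.val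

/-- Truncated symmetry `U_{[p,q]}((a,b)) = ∏_{r=p+1}^{q-1} X_{2r-1}^a X_{2r}^b`. -/
def Ustr (n : ℕ) [NeZero n] (p q : ℕ) (g : G2) : Op n :=
  ((List.range (q - (p + 1))).map
    (fun r => PX n (2 * (p + 1 + r) - 1) ^ g.1.val * PX n (2 * (p + 1 + r)) ^ g.2.val)).prod

/-- The string order parameter `S_{[p,q]}(g) = V^L_p(g) · U_{[p,q]}(g) · V^R_q(g)`. -/
def SOPm (n : ℕ) [NeZero n] (p q : ℕ) (g : G2) : Op n :=
  VL n p g * Ustr n p q g * VR n q g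

/-- The twisted string order parameter
`T_{[p,q]}^{(g,h)} = V^R_q(g) · U(h) · V^L_p(g) · U_{[p,q]}(g)`. -/
def TSOP (n : ℕ) [NeZero n] (p q : ℕ) (g h : G2) : Op n :=
  VR n q g * Usym n h * VL n p g * Ustr n p q g

/-- The triangle-game winning operator
`O_{g,h} = (1/32)(12·1 + 12 U(g) + U(h) + U(gh) − 3T − 3U(g)T)` with `T = T_{[1,n/6+1]}^{(g,h)}`. -/
def Owin (n : ℕ) [NeZero n] (g h : G2) : Op n :=
  (32 : ℂ)⁻¹ • (12 • (1 : Op n) + 12 • Usym n g + Usym n h + Usym n (g + h)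
    - 3 • TSOP n 1 (n / 6 + 1) g h - 3 • (Usym n g * TSOP n 1 (n / 6 + 1) g h))

/-- The `n`-fold tensor product `|+⟩^{⊗n}`, with all amplitudes `(1/√2)^n`. -/
def plusState (n : ℕ) : QState n := fun _ => (((Real.sqrt 2)⁻¹ : ℝ) : ℂ) ^ n

/-- The controlled-`Z` gate between (1-based, cyclic) sites `j` and `k`. -/
def CZm (n : ℕ) [NeZero n] (j k : ℕ) : Op n :=
  Matrix.of fun s t =>
    if s = t then (if s (site n j) = 1 ∧ s (site n k) = 1 then -1 else 1) else 0

/-- The `n`-qubit cyclic cluster state `|C_n⟩ = (∏_{j=1}^n CZ_{j,j+1}) |+⟩^{⊗n}`. -/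
def cluster (n : ℕ) [NeZero n] : QState n :=
  (((List.range n).map (fun j => CZm n (j + 1) (j + 2))).prod).mulVec (plusState n)

/-- The graph-state vector `|G_r⟩ = (∏_{j=1}^n Z_j^{r_j}) |C_n⟩` for a bit string
`r ∈ {0,1}^n`. -/
def graphState (n : ℕ) [NeZero n] (r : Fin n → Fin 2) : QState n :=
  (((List.range n).map (fun j => PZ n (j + 1) ^ (r (site n (j + 1))).val)).prod).mulVec
    (cluster n)

/-- The character `b ↦ (-1)^b` of a bit. -/
def bitSign (b : Fin 2) : ℂ := (-1) ^ b.val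

lemma bitSign_add (a b : Fin 2) : bitSign (a + b) = bitSign a * bitSign b := by
  fin_cases a <;> fin_cases b <;> simp [bitSign]

lemma bitSign_zero : bitSign 0 = 1 := by simp [bitSign]

lemma star_bitSign (a : Fin 2) : star (bitSign a) = bitSign a := by
  simp [bitSign]

lemma sum_bitSign_mul (a b : Fin 2) :
    ∑ c : Fin 2, bitSign (a * c) * bitSign (b * c) = if a = b then 2 else 0 := by
  fin_cases a <;> fin_cases b <;> norm_num [bitSign]

lemma bits_add_self {n : ℕ} (v : Fin n → Fin 2) : v + v = 0 := by
  funext i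
  have h : ∀ b : Fin 2, b + b = 0 := by decide
  exact h (v i)

lemma bits_neg {n : ℕ} (v : Fin n → Fin 2) : -v = v :=
  neg_eq_of_add_eq_zero_left (bits_add_self v)

lemma bits_sub {n : ℕ} (v w : Fin n → Fin 2) : v - w = v + w := by
  rw [sub_eq_add_neg, bits_neg]

lemma site_succ (n : ℕ) [NeZero n] (j : ℕ) : site n (j + 1) = site n j + 1 := by
  ext
  simp only [site, Fin.val_add, Fin.val_one', Nat.mod_add_mod, Nat.add_mod_mod]
  congr 1
  omega

lemma site_add_period (n : ℕ) [NeZero n] (j : ℕ) : site n (j + n) = site n j := by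
  ext
  simp only [site]
  rw [show j + n + (n - 1) = j + (n - 1) + n by omega, Nat.add_mod_right]

lemma site_fin_succ (n : ℕ) [NeZero n] (i : Fin n) : site n (i.val + 1) = i := by
  ext
  simp only [site]
  rw [show i.val + 1 + (n - 1) = i.val + n by omega, Nat.add_mod_right, Nat.mod_eq_of_lt i.isLt]

lemma site_succ_ne (n : ℕ) [NeZero n] (hn : 2 ≤ n) (j : ℕ) : site n (j + 1) ≠ site n j := by
  intro h
  have h' : j + (n - 1) + 1 ≡ j + (n - 1) + 0 [MOD n] := by
    have := congrArg Fin.val h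
    rwa [site, site, Fin.val_mk, Fin.val_mk, add_right_comm] at this
  have := h'.add_left_cancel'
  rw [Nat.ModEq, Nat.mod_eq_of_lt (by omega), Nat.zero_mod] at this
  exact one_ne_zero this

/-- The bit string with a single `1` at the cyclic site `j`. -/
def siteBit (n : ℕ) [NeZero n] (j : ℕ) : Fin n → Fin 2 := Pi.single (site n j) 1

lemma siteBit_add_period (n : ℕ) [NeZero n] (j : ℕ) : siteBit n (j + n) = siteBit n j := by
  rw [siteBit, site_add_period, siteBit]

lemma PZ_mulVec (n : ℕ) [NeZero n] (j : ℕ) (ψ : QState n) (s : Fin n → Fin 2) :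
    (PZ n j *ᵥ ψ) s = bitSign (s (site n j)) * ψ s := by
  rw [Matrix.mulVec, dotProduct, Finset.sum_eq_single s]
  · have h : ∀ b : Fin 2, Zmat b b = bitSign b := by
      intro b
      fin_cases b <;> simp [Zmat, bitSign]
    simp [PZ, onSite, h]
  · intro t _ ht
    simp only [PZ, onSite, Matrix.of_apply]
    split_ifs with hk
    · have hne : s (site n j) ≠ t (site n j) := by
        intro he
        apply ht
        funext k
        by_cases hkj : k = site n j
        · rw [hkj, he]
        · exact (hk k hkj).symm
      have h : ∀ a b : Fin 2, a ≠ b → Zmat a b = 0 := by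
        intro a b hab
        fin_cases a <;> fin_cases b <;> simp_all [Zmat]
      rw [h _ _ hne]
      ring
    · ring
  · simp

lemma PX_mulVec (n : ℕ) [NeZero n] (j : ℕ) (ψ : QState n) (s : Fin n → Fin 2) :
    (PX n j *ᵥ ψ) s = ψ (s + siteBit n j) := by
  rw [Matrix.mulVec, dotProduct, Finset.sum_eq_single (s + siteBit n j)]
  · have h : ∀ b : Fin 2, Xmat b (b + 1) = 1 := by
      intro b
      fin_cases b <;> simp [Xmat]
    have hk : ∀ k, k ≠ site n j → s k = (s + siteBit n j) k := by
      intro k hk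
      simp [siteBit, hk]
    simp only [PX, onSite, Matrix.of_apply, if_pos hk]
    simp [siteBit, h]
  · intro t _ ht
    simp only [PX, onSite, Matrix.of_apply]
    split_ifs with hk
    · have hne : t (site n j) ≠ s (site n j) + 1 := by
        intro he
        apply ht
        funext k
        by_cases hkj : k = site n j
        · rw [hkj, he]
          simp [siteBit]
        · simp [siteBit, hkj, hk k hkj]
      have h : ∀ a b : Fin 2, b ≠ a + 1 → Xmat a b = 0 := by
        intro a b hab
        fin_cases a <;> fin_cases b <;> simp_all [Xmat]
      rw [h _ _ hne]
      ring
    · ring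
  · simp

lemma PZ_pow_mulVec (n : ℕ) [NeZero n] (j : ℕ) (b : Fin 2) (ψ : QState n)
    (s : Fin n → Fin 2) :
    ((PZ n j ^ b.val) *ᵥ ψ) s = bitSign (b * s (site n j)) * ψ s := by
  fin_cases b
  · simp [bitSign_zero]
  · simp [PZ_mulVec]

lemma CZm_mulVec (n : ℕ) [NeZero n] (j k : ℕ) (ψ : QState n) (s : Fin n → Fin 2) :
    (CZm n j k *ᵥ ψ) s = bitSign (s (site n j) * s (site n k)) * ψ s := by
  have h : ∀ a b : Fin 2, (if a = 1 ∧ b = 1 then (-1 : ℂ) else 1) = bitSign (a * b) := by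
    intro a b
    fin_cases a <;> fin_cases b <;> simp [bitSign]
  rw [Matrix.mulVec, dotProduct, Finset.sum_eq_single s]
  · simp [CZm, h]
  · intro t _ ht
    simp [CZm, ht.symm]
  · simp

/-- A product of operators, each acting by pointwise multiplication, acts by pointwise
multiplication with the product. -/
lemma prod_range_mulVec {n : ℕ} (M : ℕ → Op n) (f : ℕ → (Fin n → Fin 2) → ℂ)
    (hM : ∀ j ψ s, (M j *ᵥ ψ) s = f j s * ψ s) (m : ℕ) (ψ : QState n) (s : Fin n → Fin 2) :
    (((List.range m).map M).prod *ᵥ ψ) s = (∏ j ∈ Finset.range m, f j s) * ψ s := by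
  induction m generalizing ψ with
  | zero => simp
  | succ m ih =>
    rw [List.range_succ, List.map_append, List.prod_append, ← Matrix.mulVec_mulVec, ih,
      Finset.prod_range_succ]
    simp [hM, mul_assoc]

/-- The amplitudes of the graph state `|G_r⟩`. -/
lemma graphState_apply (n : ℕ) [NeZero n] (r s : Fin n → Fin 2) :
    graphState n r s = (∏ i, bitSign (r i * s i)) * (∏ i, bitSign (s i * s (i + 1)))
      * (((Real.sqrt 2)⁻¹ : ℝ) : ℂ) ^ n := by
  rw [graphState, prod_range_mulVec _
    (fun j s => bitSign (r (site n (j + 1)) * s (site n (j + 1))))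
    (fun j ψ s => PZ_pow_mulVec n (j + 1) _ ψ s), cluster, prod_range_mulVec _
    (fun j s => bitSign (s (site n (j + 1)) * s (site n (j + 2))))
    (fun j ψ s => CZm_mulVec n (j + 1) (j + 2) ψ s), Finset.prod_range, Finset.prod_range]
  simp only [site_succ n (_ + 1), site_fin_succ, plusState, mul_assoc]

lemma PZ_mulVec_graphState (n : ℕ) [NeZero n] (j : ℕ) (r : Fin n → Fin 2) :
    PZ n j *ᵥ graphState n r = graphState n (r + siteBit n j) := by
  funext s
  have h : ∏ i, bitSign (siteBit n j i * s i) = bitSign (s (site n j)) := by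
    rw [Finset.prod_eq_single (site n j)]
    · simp [siteBit]
    · intro i _ hi
      simp [siteBit, hi, bitSign_zero]
    · simp
  simp only [PZ_mulVec, graphState_apply, Pi.add_apply, add_mul, bitSign_add,
    Finset.prod_mul_distrib, h]
  ring

lemma PX_mulVec_graphState (n : ℕ) [NeZero n] (hn : 2 ≤ n) (j : ℕ) (r : Fin n → Fin 2) :
    PX n (j + 1) *ᵥ graphState n r
      = bitSign (r (site n (j + 1))) • graphState n (r + siteBit n j + siteBit n (j + 2)) := by
  funext s
  rw [← PZ_mulVec_graphState, Pi.smul_apply, PZ_mulVec, ← PZ_mulVec_graphState, PZ_mulVec,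
    PX_mulVec, smul_eq_mul]
  have h1 : ∏ i, bitSign (r i * siteBit n (j + 1) i) = bitSign (r (site n (j + 1))) := by
    rw [Finset.prod_eq_single (site n (j + 1))]
    · simp [siteBit]
    · intro i _ hi
      simp [siteBit, hi, bitSign_zero]
    · simp
  have h2 : ∏ i, bitSign (siteBit n (j + 1) i * s (i + 1)) = bitSign (s (site n (j + 2))) := by
    rw [Finset.prod_eq_single (site n (j + 1))]
    · simp [siteBit, ← site_succ]
    · intro i _ hi
      simp [siteBit, hi, bitSign_zero]
    · simp
  have h3 : ∏ i, bitSign (s i * siteBit n (j + 1) (i + 1)) = bitSign (s (site n j)) := by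
    rw [Finset.prod_eq_single (site n j)]
    · simp [siteBit, site_succ]
    · intro i _ hi
      simp [siteBit, site_succ, hi, bitSign_zero]
    · simp
  have h4 : ∏ i, bitSign (siteBit n (j + 1) i * siteBit n (j + 1) (i + 1)) = 1 := by
    refine Finset.prod_eq_one fun i _ => ?_
    by_cases hi : i = site n (j + 1)
    · subst hi
      rw [← site_succ]
      simp [siteBit, site_succ_ne n hn (j + 1), bitSign_zero]
    · simp [siteBit, hi, bitSign_zero]
  simp only [graphState_apply, Pi.add_apply, mul_add, add_mul, bitSign_add,
    Finset.prod_mul_distrib, h1, h2, h3, h4]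
  ring

lemma star_graphState (n : ℕ) [NeZero n] (r : Fin n → Fin 2) :
    star (graphState n r) = graphState n r := by
  funext s
  rw [Pi.star_apply, graphState_apply]
  simp only [star_mul', star_prod, star_bitSign, star_pow]
  simp

lemma graphState_orthonormal (n : ℕ) [NeZero n] (r s : Fin n → Fin 2) :
    star (graphState n r) ⬝ᵥ graphState n s = if r = s then 1 else 0 := by
  have hsq : ∀ a : Fin 2, bitSign a * bitSign a = 1 := by
    intro a
    fin_cases a <;> simp [bitSign]
  have hamp : (((Real.sqrt 2)⁻¹ : ℝ) : ℂ) * (((Real.sqrt 2)⁻¹ : ℝ) : ℂ) = 2⁻¹ := by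
    rw [← Complex.ofReal_mul, ← mul_inv, Real.mul_self_sqrt (by norm_num)]
    simp
  have hterm : ∀ t, graphState n r t * graphState n s t
      = (2⁻¹ : ℂ) ^ n * ∏ i, (bitSign (r i * t i) * bitSign (s i * t i)) := by
    intro t
    have hone : (∏ i, bitSign (t i * t (i + 1))) * (∏ i, bitSign (t i * t (i + 1))) = 1 := by
      rw [← Finset.prod_mul_distrib]
      exact Finset.prod_eq_one fun i _ => hsq _
    rw [graphState_apply, graphState_apply, Finset.prod_mul_distrib, ← hamp, mul_pow]
    linear_combination (∏ i, bitSign (r i * t i)) * (∏ i, bitSign (s i * t i))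
      * (((Real.sqrt 2)⁻¹ : ℝ) : ℂ) ^ n * (((Real.sqrt 2)⁻¹ : ℝ) : ℂ) ^ n * hone
  rw [star_graphState, dotProduct, Finset.sum_congr rfl fun t _ => hterm t, ← Finset.mul_sum]
  have hfac := Finset.prod_univ_sum (fun _ : Fin n => (Finset.univ : Finset (Fin 2)))
    (fun i c => bitSign (r i * c) * bitSign (s i * c))
  rw [Fintype.piFinset_univ] at hfac
  rw [← hfac]
  simp only [sum_bitSign_mul]
  split_ifs with h
  · subst h
    simp
  · obtain ⟨i, hi⟩ := Function.ne_iff.1 h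
    rw [Finset.prod_eq_zero (Finset.mem_univ i) (if_neg hi), mul_zero]

/-- An orthonormal family indexed by the standard basis is complete. -/
lemma sum_vecMulVec_eq_one_of_orthonormal {ι : Type*} [Fintype ι] [DecidableEq ι]
    (G : ι → ι → ℂ) (hG : ∀ r s, star (G r) ⬝ᵥ G s = if r = s then 1 else 0) :
    ∑ r, Matrix.vecMulVec (G r) (star (G r)) = 1 := by
  have h : (Matrix.of fun r t => star (G r t)) * (Matrix.of fun t s => G s t) = 1 := by
    ext r s
    rw [Matrix.mul_apply, Matrix.one_apply, ← hG r s]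
    rfl
  rw [mul_eq_one_comm] at h
  rw [← h]
  ext t u
  simp [Matrix.sum_apply, Matrix.vecMulVec_apply, Matrix.mul_apply]

/-- If `O` is diagonal in an orthonormal basis, `tr(ρ O)` only sees the diagonal of `ρ`. -/
lemma trace_mul_eq_sum_of_eigenbasis {ι : Type*} [Fintype ι] [DecidableEq ι]
    (G : ι → ι → ℂ) (hG : ∀ r s, star (G r) ⬝ᵥ G s = if r = s then 1 else 0)
    (O ρ : Matrix ι ι ℂ) (c : ι → ℂ) (hO : ∀ r, O *ᵥ G r = c r • G r) :
    (ρ * O).trace = ∑ r, (star (G r) ⬝ᵥ ρ *ᵥ G r) *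
      (Matrix.vecMulVec (G r) (star (G r)) * O).trace := by
  have hc : ∀ r, (Matrix.vecMulVec (G r) (star (G r)) * O).trace = c r := by
    intro r
    rw [Matrix.trace_mul_comm, Matrix.mul_vecMulVec, Matrix.trace_vecMulVec, hO,
      smul_dotProduct, dotProduct_comm, hG]
    simp
  conv_lhs => rw [← mul_one (ρ * O), ← sum_vecMulVec_eq_one_of_orthonormal G hG,
    Finset.mul_sum, Matrix.trace_sum]
  refine Finset.sum_congr rfl fun r _ => ?_
  rw [hc, Matrix.mul_vecMulVec, Matrix.trace_vecMulVec, ← Matrix.mulVec_mulVec, hO,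
    Matrix.mulVec_smul, smul_dotProduct, dotProduct_comm, smul_eq_mul, mul_comm]

/-- `M` maps every graph state `|G_r⟩` to a multiple of `|G_{r+v}⟩`. -/
def ShiftsGraph (n : ℕ) [NeZero n] (M : Op n) (v : Fin n → Fin 2) : Prop :=
  ∀ r, ∃ c : ℂ, M *ᵥ graphState n r = c • graphState n (r + v)

namespace ShiftsGraph

variable {n : ℕ} [NeZero n] {M N : Op n} {v w : Fin n → Fin 2}

lemma one : ShiftsGraph n 1 0 := fun r => ⟨1, by simp⟩

lemma mul (hM : ShiftsGraph n M v) (hN : ShiftsGraph n N w) :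
    ShiftsGraph n (M * N) (v + w) := by
  intro r
  obtain ⟨c, hc⟩ := hN r
  obtain ⟨d, hd⟩ := hM (r + w)
  refine ⟨c * d, ?_⟩
  rw [← Matrix.mulVec_mulVec, hc, Matrix.mulVec_smul, hd, smul_smul,
    show r + w + v = r + (v + w) by abel]

lemma pow (hM : ShiftsGraph n M v) (k : ℕ) : ShiftsGraph n (M ^ k) (k • v) := by
  induction k with
  | zero => simpa using one
  | succ k ih =>
    rw [pow_succ, succ_nsmul]
    exact ih.mul hM

lemma add (hM : ShiftsGraph n M v) (hN : ShiftsGraph n N v) : ShiftsGraph n (M + N) v := by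
  intro r
  obtain ⟨c, hc⟩ := hM r
  obtain ⟨d, hd⟩ := hN r
  exact ⟨c + d, by rw [Matrix.add_mulVec, hc, hd, add_smul]⟩

lemma smul (hM : ShiftsGraph n M v) (a : ℂ) : ShiftsGraph n (a • M) v := by
  intro r
  obtain ⟨c, hc⟩ := hM r
  exact ⟨a * c, by rw [Matrix.smul_mulVec, hc, smul_smul]⟩

lemma nsmul (hM : ShiftsGraph n M v) (k : ℕ) : ShiftsGraph n (k • M) v := by
  simpa only [Nat.cast_smul_eq_nsmul] using hM.smul (k : ℂ)

lemma sub (hM : ShiftsGraph n M v) (hN : ShiftsGraph n N v) : ShiftsGraph n (M - N) v := by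
  simpa [sub_eq_add_neg] using hM.add (hN.smul (-1))

lemma pauliZ (j : ℕ) : ShiftsGraph n (PZ n j) (siteBit n j) :=
  fun r => ⟨1, by rw [PZ_mulVec_graphState, one_smul]⟩

lemma pauliX (hn : 2 ≤ n) (j : ℕ) :
    ShiftsGraph n (PX n (j + 1)) (siteBit n (j + 2) - siteBit n j) :=
  fun r => ⟨_, by rw [PX_mulVec_graphState n hn, bits_sub,
    show r + siteBit n j + siteBit n (j + 2) = r + (siteBit n (j + 2) + siteBit n j) by abel]⟩

/-- A run of `m` two-site blocks of `X` operators shifts only by its boundary. -/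
lemma blockProd (hn : 2 ≤ n) (k a b m : ℕ) :
    ShiftsGraph n ((List.range m).map
        (fun p => PX n (k + 2 * p + 1) ^ a * PX n (k + 2 * p + 2) ^ b)).prod
      (a • (siteBit n (k + 2 * m) - siteBit n k)
        + b • (siteBit n (k + 2 * m + 1) - siteBit n (k + 1))) := by
  induction m with
  | zero => simpa using one
  | succ m ih =>
    rw [List.range_succ, List.map_append, List.prod_append]
    have h := ih.mul (((pauliX hn (k + 2 * m)).pow a).mul ((pauliX hn (k + 2 * m + 1)).pow b))
    have e : k + 2 * (m + 1) = k + 2 * m + 2 := by ring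
    rw [e]
    simp only [List.map_cons, List.map_nil, List.prod_cons, List.prod_nil, mul_one]
    convert h using 1
    simp only [smul_sub]
    abel

lemma globalSymmetry (hn : 2 ≤ n) (he : 2 ∣ n) (g : G2) : ShiftsGraph n (Usym n g) 0 := by
  have h := blockProd hn 0 g.1.val g.2.val (n / 2)
  have e : 0 + 2 * (n / 2) = 0 + n := by omega
  rw [e, show 0 + n + 1 = 1 + n by omega, siteBit_add_period, siteBit_add_period] at h
  simpa [Usym] using h

lemma twistedString (hn : 2 ≤ n) (he : 2 ∣ n) (m : ℕ) (g h : G2) :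
    ShiftsGraph n (TSOP n 1 (m + 2) g h) 0 := by
  obtain ⟨a, b⟩ := g
  have hR : ShiftsGraph n (VR n (m + 2) (a, b))
      (b.val • siteBit n (2 * m + 3) + a.val • (siteBit n (2 * m + 4) - siteBit n (2 * m + 2))
        + a.val • siteBit n (2 * m + 4)) :=
    (((pauliZ _).pow _).mul ((pauliX hn (2 * m + 2)).pow _)).mul ((pauliZ _).pow _)
  have hL : ShiftsGraph n (VL n 1 (a, b))
      (b.val • siteBit n 1 + (b.val • (siteBit n 3 - siteBit n 1) + a.val • siteBit n 2)) :=
    ((pauliZ _).pow _).mul (((pauliX hn 1).pow _).mul ((pauliZ _).pow _))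
  have hU : ShiftsGraph n (Ustr n 1 (m + 2) (a, b))
      (a.val • (siteBit n (2 + 2 * m) - siteBit n 2)
        + b.val • (siteBit n (2 + 2 * m + 1) - siteBit n 3)) := by
    have key := blockProd hn 2 a.val b.val m
    convert key using 1
    rw [Ustr, show m + 2 - (1 + 1) = m by omega]
    congr 2
    funext p
    rw [show 2 * (1 + 1 + p) - 1 = 2 + 2 * p + 1 by omega,
      show 2 * (1 + 1 + p) = 2 + 2 * p + 2 by omega]
  have hT := ((hR.mul (globalSymmetry hn he h)).mul hL).mul hU
  rw [show 2 + 2 * m + 1 = 2 * m + 3 by omega, show 2 + 2 * m = 2 * m + 2 by omega] at hT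
  have e3 := bits_add_self (b.val • siteBit n (2 * m + 3))
  have e4 := bits_add_self (a.val • siteBit n (2 * m + 4))
  have hzero : b.val • siteBit n (2 * m + 3)
      + a.val • (siteBit n (2 * m + 4) - siteBit n (2 * m + 2)) + a.val • siteBit n (2 * m + 4) + 0
      + (b.val • siteBit n 1 + (b.val • (siteBit n 3 - siteBit n 1) + a.val • siteBit n 2))
      + (a.val • (siteBit n (2 * m + 2) - siteBit n 2)
        + b.val • (siteBit n (2 * m + 3) - siteBit n 3))
      = (b.val • siteBit n (2 * m + 3) + b.val • siteBit n (2 * m + 3))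
        + (a.val • siteBit n (2 * m + 4) + a.val • siteBit n (2 * m + 4)) := by
    simp only [smul_sub]
    abel
  rw [hzero, e3, e4, add_zero] at hT
  exact hT

lemma winningOperator (hn4 : 4 ≤ n) (hn : 6 ∣ n) (g h : G2) :
    ShiftsGraph n (Owin n g h) 0 := by
  have hn2 : 2 ≤ n := by omega
  have he : 2 ∣ n := by omega
  obtain ⟨m, hm⟩ : ∃ m, n / 6 + 1 = m + 2 := ⟨n / 6 - 1, by omega⟩
  have hU := fun k => globalSymmetry hn2 he k
  have hT := twistedString hn2 he m g h
  have hUT := (hU g).mul hT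
  rw [add_zero] at hUT
  rw [Owin, hm]
  exact (((((((one.nsmul 12).add ((hU g).nsmul 12)).add (hU h)).add (hU (g + h))).sub
    (hT.nsmul 3)).sub (hUT.nsmul 3))).smul _

end ShiftsGraph

lemma Kstab_mulVec_graphState (n : ℕ) [NeZero n] (hn : 2 ≤ n) (r : Fin n → Fin 2) (j : ℕ) :
    Kstab n (j + 1) *ᵥ graphState n r = bitSign (r (site n (j + 1))) • graphState n r := by
  have hne : site n (j + 1) ≠ site n (j + 2) := (site_succ_ne n hn (j + 1)).symm
  rw [Kstab, ← Matrix.mulVec_mulVec, ← Matrix.mulVec_mulVec, PZ_mulVec_graphState,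
    PX_mulVec_graphState n hn, Matrix.mulVec_smul, PZ_mulVec_graphState]
  congr 2
  · simp [siteBit, hne]
  · simp only [Nat.add_sub_cancel]
    rw [show r + siteBit n (j + 1 + 1) + siteBit n j + siteBit n (j + 2) + siteBit n j
      = r + (siteBit n (j + 2) + siteBit n (j + 2)) + (siteBit n j + siteBit n j) by abel,
      bits_add_self, bits_add_self, add_zero, add_zero]

/-- Theorem 2: the graph states `|G_r⟩` form an orthonormal basis with
`K_j|G_r⟩ = (−1)^{r_j}|G_r⟩`, and the triangle-game winning probability of any density matrix
`ρ` depends only on its graph-diagonal components: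
`P_n^{(Q)}(g,h|ρ) = Σ_r ⟨G_r|ρ|G_r⟩ P_n^{(Q)}(g,h||G_r⟩⟨G_r|)`. -/
theorem graph_diagonal_decomposition (n : ℕ) [NeZero n] (hn4 : 4 ≤ n) (hn : 6 ∣ n) :
    (∀ r s : Fin n → Fin 2,
      star (graphState n r) ⬝ᵥ graphState n s = if r = s then 1 else 0) ∧
    (∑ r : Fin n → Fin 2,
      Matrix.vecMulVec (graphState n r) (star (graphState n r)) = (1 : Op n)) ∧
    (∀ (r : Fin n → Fin 2) (j : ℕ), 1 ≤ j → j ≤ n →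
      (Kstab n j).mulVec (graphState n r)
        = ((-1 : ℂ) ^ (r (site n j)).val) • graphState n r) ∧
    (∀ ρ : Op n, ρ.PosSemidef → ρ.trace = 1 →
      ∀ g h : G2, g ≠ 0 → h ≠ 0 → g ≠ h →
        (ρ * Owin n g h).trace
          = ∑ r : Fin n → Fin 2,
              (star (graphState n r) ⬝ᵥ ρ.mulVec (graphState n r)) *
                (Matrix.vecMulVec (graphState n r) (star (graphState n r)) *
                  Owin n g h).trace) := by
  refine ⟨graphState_orthonormal n,
    sum_vecMulVec_eq_one_of_orthonormal _ (graphState_orthonormal n), ?_, ?_⟩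
  · intro r j hj _
    obtain ⟨k, rfl⟩ := Nat.exists_eq_add_of_le' hj
    exact Kstab_mulVec_graphState n (by omega) r k
  · intro ρ _ _ g h _ _ _
    choose c hc using ShiftsGraph.winningOperator hn4 hn g h
    exact trace_mul_eq_sum_of_eigenbasis _ (graphState_orthonormal n) _ _ c
      fun r => by simpa using hc r
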